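/- arXiv:1507.04917 — 2 statements merged into one kernel-verified Lean document; each statement's English description precedes it below -/
import Mathlib

section
/- For all sufficiently large primes p the following hold. (i) Σ_{k=1}^{p−1} (−1)^k/k ≡ −2·(2^{p−1}−1)/p (mod p). (ii) For every odd integer s > 2: Σ_{k=1}^{p−1} (−1)^k/k^s ≡ −2(1−2^{1−s})·B_{p−s}/s (mod p). (iii) For every even positive integer s: Σ_{k=1}^{p−1} (−1)^k/k^s ≡ s(1−2^{−s})·p·B_{p−s−1}/(s+1) (mod p²). (In (ii) and (iii) the threshold for p may depend on s.) -/
open scoped BigOperators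

/-- Alternating multiple harmonic sum `H_n(𝐬)` where `𝐬` is a list of pairs
`(sⱼ, εⱼ)` (exponent, sign):
`H_n(𝐬) = Σ_{n ≥ k₁ > ⋯ > k_d ≥ 1} Π εⱼ^{kⱼ} / kⱼ^{sⱼ}`. -/
def AMHS : ℕ → List (ℕ × ℚ) → ℚ
  | _, [] => 1
  | n, (s, ε) :: t => ∑ k ∈ Finset.Icc 1 n, ε ^ k / (k : ℚ) ^ s * AMHS (k - 1) t

/-- Alternating multiple harmonic star sum `H⋆_n(𝐬)` (indices weakly decreasing). -/
def AMHSstar : ℕ → List (ℕ × ℚ) → ℚ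
  | _, [] => 1
  | n, (s, ε) :: t => ∑ k ∈ Finset.Icc 1 n, ε ^ k / (k : ℚ) ^ s * AMHSstar k t

/-- A list of pairs is a signed composition: positive exponents, signs `±1`. -/
def IsSignedComp (l : List (ℕ × ℚ)) : Prop := ∀ x ∈ l, 0 < x.1 ∧ (x.2 = 1 ∨ x.2 = -1)

/-- `a ≡ b (mod p^ℓ)` for rationals: the `p`-adic valuation of `a - b` is at least `ℓ`. -/
def RatModEq (p ℓ : ℕ) (a b : ℚ) : Prop := a = b ∨ (ℓ : ℤ) ≤ padicValRat p (a - b)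

/-- View a composition of positive integers as a signed composition with all signs `+1`. -/
def posComp (l : List ℕ) : List (ℕ × ℚ) := l.map (fun s => (s, 1))

/-- `x` is divisible by `p^l` in the localization of `ℤ` at `p`. -/
def PDvd (p l : ℕ) (x : ℚ) : Prop :=
  ∃ a b : ℤ, ¬ (p : ℤ) ∣ b ∧ x * b = (p : ℚ) ^ l * a

namespace PDvd

theorem toRatModEq {p l : ℕ} (hp : p.Prime) {x y : ℚ} (h : PDvd p l (x - y)) :
    RatModEq p l x y := by
  haveI := Fact.mk hp
  obtain ⟨a, b, hb, hx⟩ := h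
  by_cases hxy : x = y
  · exact Or.inl hxy
  right
  have hb0 : b ≠ 0 := by rintro rfl; simp at hb
  have hbq : (b : ℚ) ≠ 0 := by exact_mod_cast hb0
  have hsub : x - y ≠ 0 := sub_ne_zero.mpr hxy
  have hpq : (p : ℚ) ≠ 0 := by exact_mod_cast hp.ne_zero
  have haq : (a : ℚ) ≠ 0 := by
    intro h0
    rw [h0, mul_zero] at hx
    exact (mul_ne_zero hsub hbq) hx
  have h1 := congrArg (padicValRat p) hx
  rw [padicValRat.mul hsub hbq, padicValRat.mul (pow_ne_zero _ hpq) haq,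
    padicValRat.pow, padicValRat.self hp.one_lt, padicValRat.of_int, padicValRat.of_int,
    padicValInt.eq_zero_of_not_dvd hb] at h1
  have : (0 : ℤ) ≤ (padicValInt p a : ℤ) := by positivity
  push_cast at h1
  linarith

variable {p l : ℕ}

theorem ofInt (hp : p.Prime) {z : ℤ} (h : (p : ℤ) ^ l ∣ z) : PDvd p l (z : ℚ) := by
  obtain ⟨c, rfl⟩ := h
  refine ⟨c, 1, ?_, by push_cast; ring⟩
  intro h
  have := Int.le_of_dvd one_pos h
  have := hp.two_le
  omega

theorem ofInt0 (hp : p.Prime) (z : ℤ) : PDvd p 0 (z : ℚ) := ofInt hp (by simp)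

theorem inv (hp : p.Prime) {b : ℤ} (h : ¬ (p : ℤ) ∣ b) : PDvd p 0 ((b : ℚ)⁻¹) := by
  refine ⟨1, b, h, ?_⟩
  have hb0 : b ≠ 0 := by rintro rfl; simp at h
  have hbq : (b : ℚ) ≠ 0 := by exact_mod_cast hb0
  simp [hbq]

theorem mul (hp : p.Prime) {k : ℕ} {x y : ℚ} (hx : PDvd p l x) (hy : PDvd p k y) :
    PDvd p (l + k) (x * y) := by
  obtain ⟨a, b, hb, h⟩ := hx
  obtain ⟨c, d, hd, h'⟩ := hy
  refine ⟨a * c, b * d, ?_, ?_⟩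
  · intro hh
    rcases (Nat.prime_iff_prime_int.mp hp).dvd_or_dvd hh with h | h
    · exact hb h
    · exact hd h
  · push_cast
    calc x * y * (b * d) = (x * b) * (y * d) := by ring
      _ = _ := by rw [h, h']; ring

theorem mul0 (hp : p.Prime) {x y : ℚ} (hx : PDvd p l x) (hy : PDvd p 0 y) :
    PDvd p l (x * y) := mul hp hx hy

theorem add (hp : p.Prime) {x y : ℚ} (hx : PDvd p l x) (hy : PDvd p l y) :
    PDvd p l (x + y) := by
  obtain ⟨a, b, hb, h⟩ := hx
  obtain ⟨c, d, hd, h'⟩ := hy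
  refine ⟨a * d + c * b, b * d, ?_, ?_⟩
  · intro hh
    rcases (Nat.prime_iff_prime_int.mp hp).dvd_or_dvd hh with h | h
    · exact hb h
    · exact hd h
  · push_cast
    calc (x + y) * (b * d) = (x * b) * d + (y * d) * b := by ring
      _ = _ := by rw [h, h']; ring

theorem neg {x : ℚ} (hx : PDvd p l x) : PDvd p l (-x) := by
  obtain ⟨a, b, hb, h⟩ := hx
  exact ⟨-a, b, hb, by push_cast; linarith⟩

theorem sub (hp : p.Prime) {x y : ℚ} (hx : PDvd p l x) (hy : PDvd p l y) :
    PDvd p l (x - y) := by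
  rw [sub_eq_add_neg]; exact add hp hx (neg hy)

theorem sum (hp : p.Prime) {ι : Type*} (s : Finset ι) (f : ι → ℚ)
    (h : ∀ i ∈ s, PDvd p l (f i)) : PDvd p l (∑ i ∈ s, f i) := by
  classical
  induction s using Finset.induction_on with
  | empty => simpa using ofInt (l := l) hp (dvd_zero _)
  | insert a s ha ih =>
    rw [Finset.sum_insert ha]
    exact add hp (h _ (by simp)) (ih fun i hi => h i (by simp [hi]))

theorem mono {k : ℕ} (hkl : k ≤ l) {x : ℚ} (hx : PDvd p l x) : PDvd p k x := by
  obtain ⟨a, b, hb, h⟩ := hx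
  refine ⟨p ^ (l - k) * a, b, hb, ?_⟩
  rw [h]; push_cast
  rw [← mul_assoc, ← pow_add]; congr 2; omega

/-- cancel a power of `p` -/
theorem cancel (hp : p.Prime) {x : ℚ} (hx : PDvd p (l + 1) (p * x)) : PDvd p l x := by
  obtain ⟨a, b, hb, h⟩ := hx
  refine ⟨a, b, hb, ?_⟩
  have hpq : (p : ℚ) ≠ 0 := by exact_mod_cast hp.ne_zero
  apply mul_left_cancel₀ hpq
  rw [← mul_assoc, h]; ring

end PDvd

theorem not_dvd_lt {p k : ℕ} (h1 : 1 ≤ k) (h2 : k < p) : ¬ (p : ℤ) ∣ (k : ℤ) := by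
  intro h
  have := Nat.le_of_dvd (by omega) (Int.natCast_dvd_natCast.mp h)
  omega

theorem PDvd.invNat {p k : ℕ} (hp : p.Prime) (h1 : 1 ≤ k) (h2 : k < p) :
    PDvd p 0 ((k : ℚ)⁻¹) := by
  simpa using PDvd.inv hp (not_dvd_lt h1 h2)

theorem PDvd.invPow {p k : ℕ} (hp : p.Prime) (h1 : 1 ≤ k) (h2 : k < p) (s : ℕ) :
    PDvd p 0 (((k : ℚ) ^ s)⁻¹) := by
  have := PDvd.inv (p := p) (b := (k : ℤ) ^ s) hp
    (fun h => not_dvd_lt h1 h2 ((Nat.prime_iff_prime_int.mp hp).dvd_of_dvd_pow h))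
  simpa using this

theorem bern'_int {p : ℕ} (hp : p.Prime) (n : ℕ) (hn : n + 2 ≤ p) : PDvd p 0 (bernoulli' n) := by
  induction n using Nat.strong_induction_on with
  | _ n ih =>
    rw [bernoulli'_def]
    apply PDvd.sub hp
    · simpa using PDvd.ofInt0 hp 1
    · apply PDvd.sum hp
      intro k hk
      have hk := Finset.mem_range.mp hk
      rw [div_eq_mul_inv]
      refine PDvd.mul0 hp (PDvd.mul0 hp ?_ ?_) (ih k hk (by omega))
      · simpa using PDvd.ofInt0 hp (n.choose k : ℤ)
      · have := PDvd.invNat (k := n - k + 1) hp (by omega) (by omega)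
        rw [Nat.cast_add, Nat.cast_sub hk.le] at this
        simpa using this

theorem bern_int {p : ℕ} (hp : p.Prime) (n : ℕ) (hn : n + 2 ≤ p) : PDvd p 0 (bernoulli n) := by
  rw [bernoulli]
  refine PDvd.mul0 hp ?_ (bern'_int hp n hn)
  simpa using PDvd.ofInt0 hp ((-1) ^ n)

theorem powsum_bern {p : ℕ} (hp : p.Prime) (n : ℕ) (h1 : 1 ≤ n) (hn : n + 2 ≤ p) :
    PDvd p 2 (∑ k ∈ Finset.Ico 1 p, (k : ℚ) ^ n - p * bernoulli n) := by
  have e : ∑ k ∈ Finset.Ico 1 p, (k : ℚ) ^ n = ∑ k ∈ Finset.range p, (k : ℚ) ^ n := by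
    rw [Finset.range_eq_Ico, Finset.sum_eq_sum_Ico_succ_bot hp.pos]
    simp [show n ≠ 0 by omega]
  rw [e, sum_range_pow, Finset.sum_range_succ]
  have hn1 : ((n : ℚ) + 1) ≠ 0 := by positivity
  have : bernoulli n * ((n + 1).choose n : ℚ) * (p : ℚ) ^ (n + 1 - n) / ((n : ℚ) + 1)
      = p * bernoulli n := by
    rw [Nat.choose_succ_self_right]
    simp
    field_simp
  rw [this, add_sub_cancel_right]
  apply PDvd.sum hp
  intro i hi
  have hi := Finset.mem_range.mp hi
  rw [div_eq_mul_inv]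
  refine PDvd.mul0 hp ?_ (by simpa using PDvd.invNat (k := n + 1) hp (by omega) (by omega))
  have := PDvd.mul hp (l := 0) (k := 2) (PDvd.mul0 hp (bern_int hp i (by omega))
    (PDvd.ofInt0 hp ((n + 1).choose i : ℤ)))
    (PDvd.ofInt hp (pow_dvd_pow (p : ℤ) (show 2 ≤ n + 1 - i by omega)))
  simpa using this

theorem refl_pow (p k : ℤ) (n : ℕ) (hn : Even n) :
    p ^ 2 ∣ (p - k) ^ n - k ^ n + n * p * k ^ (n - 1) := by
  obtain ⟨c, hc⟩ := Polynomial.powAddExpansion k (-p) n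
  have : (p - k) ^ n = (k + -p) ^ n := by
    rw [← hn.neg_pow]; ring
  rw [this, hc]
  exact ⟨c, by ring⟩

theorem sum_refl {M : Type*} [AddCommMonoid M] (p : ℕ) (f : ℕ → M) :
    ∑ k ∈ Finset.Ico 1 p, f (p - k) = ∑ k ∈ Finset.Ico 1 p, f k := by
  refine Finset.sum_nbij' (fun k => p - k) (fun k => p - k) ?_ ?_ ?_ ?_ ?_ <;>
    intro k hk <;> simp only [Finset.mem_Ico] at hk ⊢ <;> omega

theorem sum_half {M : Type*} [AddCommMonoid M] (h : ℕ) (f : ℕ → M) :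
    ∑ k ∈ Finset.Ico 1 (2 * h + 1), f k =
      ∑ k ∈ Finset.Ico 1 (h + 1), f k + ∑ k ∈ Finset.Ico 1 (h + 1), f (2 * h + 1 - k) := by
  rw [← Finset.sum_Ico_consecutive f (show 1 ≤ h + 1 by omega) (show h + 1 ≤ 2 * h + 1 by omega)]
  congr 1
  refine Finset.sum_nbij' (fun k => 2 * h + 1 - k) (fun k => 2 * h + 1 - k) ?_ ?_ ?_ ?_ ?_ <;>
    intro k hk <;> simp only [Finset.mem_Ico] at hk ⊢
  · omega
  · omega
  · omega
  · omega
  · congr 1; omega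

theorem sum_alt (h : ℕ) (f : ℕ → ℤ) :
    ∑ k ∈ Finset.Ico 1 (2 * h + 1), (-1) ^ k * f k + ∑ k ∈ Finset.Ico 1 (2 * h + 1), f k =
      2 * ∑ k ∈ Finset.Ico 1 (h + 1), f (2 * k) := by
  induction h with
  | zero => simp
  | succ h ih =>
    rw [show 2 * (h + 1) + 1 = 2 * h + 1 + 1 + 1 by ring]
    have hs : ∀ (g : ℕ → ℤ) (m : ℕ), ∑ k ∈ Finset.Ico 1 (m + 1 + 1), g k =
        ∑ k ∈ Finset.Ico 1 (m + 1), g k + g (m + 1) :=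
      fun g m => Finset.sum_Ico_succ_top (by omega) g
    rw [hs _ (2 * h + 1), hs _ (2 * h), hs _ (2 * h + 1), hs _ (2 * h), hs _ h, mul_add, ← ih]
    have h1 : (-1 : ℤ) ^ (2 * h + 1) = -1 := by rw [pow_succ, pow_mul]; simp
    have h2 : (-1 : ℤ) ^ (2 * h + 1 + 1) = 1 := by rw [pow_succ, h1]; simp
    rw [h1, h2, show 2 * (h + 1) = 2 * h + 1 + 1 by ring]
    ring

/-- key integer congruence -/
theorem key_int (h n p : ℕ) (hph : p = 2 * h + 1) (hn : Even n) (hn0 : 0 < n) :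
    (p : ℤ) ^ 2 ∣ n * p * (∑ k ∈ Finset.Ico 1 p, (-1) ^ k * (k : ℤ) ^ (n - 1))
      - 2 * (1 - 2 ^ n) * ∑ k ∈ Finset.Ico 1 p, (k : ℤ) ^ n := by
  set T := ∑ k ∈ Finset.Ico 1 p, (-1) ^ k * (k : ℤ) ^ (n - 1) with hT
  set U := ∑ k ∈ Finset.Ico 1 p, (-1) ^ k * (k : ℤ) ^ n with hU
  set S := ∑ k ∈ Finset.Ico 1 p, (k : ℤ) ^ n with hS
  set S' := ∑ k ∈ Finset.Ico 1 p, (k : ℤ) ^ (n - 1) with hS'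
  set A := ∑ k ∈ Finset.Ico 1 (h + 1), (k : ℤ) ^ n with hA
  set A' := ∑ k ∈ Finset.Ico 1 (h + 1), (k : ℤ) ^ (n - 1) with hA'
  have c1 : U + S = 2 * (2 ^ n * A) := by
    rw [hU, hS, hph, sum_alt h (fun k => (k : ℤ) ^ n), hA]
    simp [mul_pow, Finset.mul_sum]
  have c2 : T + S' = 2 ^ n * A' := by
    rw [hT, hS', hph, sum_alt h (fun k => (k : ℤ) ^ (n - 1)), hA', Finset.mul_sum, Finset.mul_sum]
    refine Finset.sum_congr rfl fun k _ => ?_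
    push_cast
    rw [mul_pow, ← mul_assoc, ← pow_succ', Nat.sub_add_cancel hn0]
  -- pairing for U
  have c3 : (p : ℤ) ^ 2 ∣ 2 * U - n * p * T := by
    have : U = ∑ k ∈ Finset.Ico 1 p, -((-1) ^ k * ((p : ℤ) - k) ^ n) := by
      rw [hU, ← sum_refl]
      refine Finset.sum_congr rfl fun k hk => ?_
      have hk := Finset.mem_Ico.mp hk
      rw [Nat.cast_sub hk.2.le]
      have : (-1 : ℤ) ^ (p - k) * (-1) ^ k = -1 := by
        rw [← pow_add, Nat.sub_add_cancel hk.2.le, hph, pow_succ, pow_mul]; simp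
      have h2 : (-1 : ℤ) ^ k * (-1) ^ k = 1 := by rw [← mul_pow]; simp
      have h3 : (-1 : ℤ) ^ (p - k) = -(-1) ^ k := by
        linear_combination (-1 : ℤ) ^ k * this - (-1 : ℤ) ^ (p - k) * h2
      rw [h3]; ring
    have e : 2 * U - n * p * T = ∑ k ∈ Finset.Ico 1 p,
        -((-1) ^ k * (((p : ℤ) - k) ^ n - (k : ℤ) ^ n + n * p * (k : ℤ) ^ (n - 1))) := by
      rw [two_mul]
      nth_rewrite 1 [this]
      rw [hU, hT, Finset.mul_sum, ← Finset.sum_add_distrib, ← Finset.sum_sub_distrib]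
      refine Finset.sum_congr rfl fun k _ => ?_
      ring
    rw [e]
    exact Finset.dvd_sum fun k _ => (dvd_neg.mpr (Dvd.dvd.mul_left (refl_pow p k n hn) _))
  have c4 : (p : ℤ) ^ 2 ∣ S - 2 * A + n * p * A' := by
    have e : S - 2 * A + n * p * A' = ∑ k ∈ Finset.Ico 1 (h + 1),
        (((p : ℤ) - k) ^ n - (k : ℤ) ^ n + n * p * (k : ℤ) ^ (n - 1)) := by
      rw [hS, hph, sum_half, hA, hA', Finset.sum_add_distrib, Finset.sum_sub_distrib,
        ← Finset.mul_sum]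
      have : ∑ k ∈ Finset.Ico 1 (h + 1), ((2 * h + 1 - k : ℕ) : ℤ) ^ n =
          ∑ k ∈ Finset.Ico 1 (h + 1), (((2 * h + 1 : ℕ) : ℤ) - k) ^ n := by
        refine Finset.sum_congr rfl fun k hk => ?_
        have hk := Finset.mem_Ico.mp hk
        rw [Nat.cast_sub (by omega)]
      rw [this]; ring
    rw [e]
    exact Finset.dvd_sum fun k _ => refl_pow p k n hn
  have c5 : (p : ℤ) ∣ 2 * S' := by
    have e : 2 * S' = ∑ k ∈ Finset.Ico 1 p, ((k : ℤ) ^ (n - 1) + ((p - k : ℕ) : ℤ) ^ (n - 1)) := by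
      rw [Finset.sum_add_distrib, sum_refl p (fun k => (k : ℤ) ^ (n - 1)), two_mul]
    rw [e]
    refine Finset.dvd_sum fun k hk => ?_
    have hk := Finset.mem_Ico.mp hk
    have ho : Odd (n - 1) := Nat.Even.sub_odd hn0 hn odd_one
    have := ho.add_dvd_pow_add_pow (k : ℤ) ((p - k : ℕ) : ℤ)
    rw [Nat.cast_sub hk.2.le, add_sub_cancel] at this
    rwa [Nat.cast_sub hk.2.le]
  have c6 : (p : ℤ) ∣ S' := by
    have hc : IsCoprime (p : ℤ) 2 := ⟨1, -h, by rw [hph]; push_cast; ring⟩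
    exact hc.dvd_of_dvd_mul_left c5
  obtain ⟨a, ha⟩ := c3
  obtain ⟨b, hb⟩ := c4
  obtain ⟨c, hc⟩ := c6
  refine ⟨a + 2 * 2 ^ n * b - 2 * n * c, ?_⟩
  linear_combination (-1 : ℤ) * 2 * c1 + 2 * n * p * c2 + ha + 2 * 2 ^ n * hb - 2 * n * p * hc

theorem fermat {p k : ℕ} (hp : p.Prime) (h1 : 1 ≤ k) (h2 : k < p) :
    (p : ℤ) ∣ 1 - (k : ℤ) ^ (p - 1) := by
  have := Int.ModEq.pow_card_sub_one_eq_one hp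
    (show IsCoprime (k : ℤ) p from
      Nat.isCoprime_iff_coprime.mpr (Nat.coprime_of_lt_prime (by omega) h2 hp).symm)
  exact (Int.modEq_iff_dvd.mp this)

theorem part_two (s p : ℕ) (hs : Odd s) (h2 : 2 < s) (hps : s + 3 ≤ p) (hp : p.Prime) :
    PDvd p 1 ((∑ k ∈ Finset.Ico 1 p, (-1 : ℚ) ^ k / (k : ℚ) ^ s) -
        (-2 * (1 - (2 : ℚ) ^ ((1 : ℤ) - (s : ℤ))) * (bernoulli (p - s) / (s : ℚ)))) := by
  have hodd : Odd p := hp.odd_of_ne_two (by omega)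
  obtain ⟨h, hph⟩ := hodd
  have hn : Even (p - s) := by
    apply Nat.Odd.sub_odd ⟨h, hph⟩ hs
  set n := p - s with hnd
  set T : ℤ := ∑ k ∈ Finset.Ico 1 p, (-1) ^ k * (k : ℤ) ^ (n - 1) with hT
  set R : ℚ := ∑ k ∈ Finset.Ico 1 p, (-1 : ℚ) ^ k / (k : ℚ) ^ s with hR
  have a1 : PDvd p 1 (R - T) := by
    rw [hR, hT]; push_cast
    rw [← Finset.sum_sub_distrib]
    apply PDvd.sum hp
    intro k hk
    have hk := Finset.mem_Ico.mp hk
    have hk0 : (k : ℚ) ≠ 0 := by norm_cast; omega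
    have e : (-1 : ℚ) ^ k / (k : ℚ) ^ s - (-1) ^ k * (k : ℚ) ^ (n - 1) =
        ((1 - (k : ℤ) ^ (p - 1) : ℤ) : ℚ) * (((-1 : ℤ) ^ k : ℤ) : ℚ) * ((k : ℚ) ^ s)⁻¹ := by
      rw [show p - 1 = n - 1 + s by omega]
      push_cast
      rw [pow_add]
      field_simp
    rw [e]
    exact PDvd.mul0 hp (PDvd.mul0 hp (PDvd.ofInt hp (by simpa using fermat hp hk.1 hk.2))
      (PDvd.ofInt0 hp _)) (PDvd.invPow hp hk.1 hk.2 s)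
  have a2 : PDvd p 1 ((n : ℚ) * T - 2 * (1 - 2 ^ n) * bernoulli n) := by
    apply PDvd.cancel hp
    have b1 := PDvd.ofInt hp (key_int h n p hph hn (by omega))
    have b2 := PDvd.mul0 hp (powsum_bern hp n (by omega) (by omega))
      (PDvd.ofInt0 hp (2 * (1 - 2 ^ n)))
    have b3 := PDvd.add hp b1 b2
    rw [← hT] at b3
    convert b3 using 1
    push_cast
    ring
  have a3 : PDvd p 1 ((p : ℚ) * T) := by
    have := PDvd.ofInt (l := 1) hp (z := p * T) (by simp)
    simpa using this
  have hB := bern_int hp n (by omega)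
  have a4 : PDvd p 1 ((((2 : ℤ) ^ (p - 1) - 1 : ℤ) : ℚ) * ((2 ^ s : ℚ))⁻¹ * bernoulli n * (4 : ℤ)) := by
    have f := fermat (k := 2) hp (by omega) (by omega)
    rw [← dvd_neg, neg_sub] at f
    exact PDvd.mul0 hp (PDvd.mul0 hp (PDvd.mul0 hp (PDvd.ofInt hp (by simpa using f))
      (by simpa using PDvd.invPow (k := 2) hp (by omega) (by omega) s)) hB) (PDvd.ofInt0 hp _)
  have a5 := PDvd.add hp a1 (PDvd.mul0 hp (PDvd.add hp (PDvd.sub hp a3 a2) a4)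
    (PDvd.invNat (k := s) hp (by omega) (by omega)))
  convert a5 using 1
  have hs0 : (s : ℚ) ≠ 0 := by norm_cast; omega
  have e1 : (2 : ℚ) ^ ((1 : ℤ) - (s : ℤ)) = 2 * (2 ^ s)⁻¹ := by
    rw [zpow_sub₀ (by norm_num)]; simp [div_eq_mul_inv]
  have e2 : (2 : ℚ) ^ (p - 1) = 2 ^ n * 2 ^ s / 2 := by
    rw [← pow_add, show n + s = p - 1 + 1 by omega, pow_succ]; simp
  have e3 : (n : ℚ) = p - s := by rw [hnd, Nat.cast_sub (by omega)]
  push_cast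
  rw [e1, e2, e3]
  have : (2 : ℚ) ^ s ≠ 0 := by positivity
  field_simp
  ring

theorem part_three (s p : ℕ) (hs : Even s) (h0 : 0 < s) (hps : s + 4 ≤ p) (hp : p.Prime) :
    PDvd p 2 ((∑ k ∈ Finset.Ico 1 p, (-1 : ℚ) ^ k / (k : ℚ) ^ s) -
        ((s : ℚ) * (1 - (2 : ℚ) ^ (-(s : ℤ))) * (p : ℚ) *
          (bernoulli (p - s - 1) / ((s : ℚ) + 1)))) := by
  have hodd : Odd p := hp.odd_of_ne_two (by omega)
  have h2 := part_two (s + 1) p hs.add_one (by obtain ⟨r, hr⟩ := hs; omega) (by omega) hp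
  rw [show p - (s + 1) = p - s - 1 by omega] at h2
  set R : ℚ := ∑ k ∈ Finset.Ico 1 p, (-1 : ℚ) ^ k / (k : ℚ) ^ (s + 1) with hR
  set V : ℚ := ∑ k ∈ Finset.Ico 1 p, (-1 : ℚ) ^ k / (k : ℚ) ^ s with hV
  have a1 : PDvd p 2 (2 * V + s * p * R) := by
    have hVr : V = ∑ k ∈ Finset.Ico 1 p, -((-1 : ℚ) ^ k / ((p : ℚ) - k) ^ s) := by
      rw [hV, ← sum_refl]
      refine Finset.sum_congr rfl fun k hk => ?_
      have hk := Finset.mem_Ico.mp hk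
      rw [Nat.cast_sub hk.2.le]
      have : (-1 : ℚ) ^ (p - k) * (-1) ^ k = -1 := by
        rw [← pow_add, Nat.sub_add_cancel hk.2.le, hodd.neg_one_pow]
      have h2 : (-1 : ℚ) ^ k * (-1) ^ k = 1 := by rw [← mul_pow]; simp
      have h3 : (-1 : ℚ) ^ (p - k) = -(-1) ^ k := by
        linear_combination (-1 : ℚ) ^ k * this - (-1 : ℚ) ^ (p - k) * h2
      rw [h3]; ring
    rw [two_mul]
    nth_rewrite 1 [hVr]
    rw [hV, hR, Finset.mul_sum, ← Finset.sum_add_distrib, ← Finset.sum_add_distrib]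
    apply PDvd.sum hp
    intro k hk
    have hk := Finset.mem_Ico.mp hk
    have hk0 : (k : ℚ) ≠ 0 := by norm_cast; omega
    have hpk : ((p : ℚ) - k) ≠ 0 := by
      rw [← Nat.cast_sub hk.2.le]; norm_cast; omega
    have hd : (p : ℤ) ^ 2 ∣ (k + s * p) * ((p : ℤ) - k) ^ s - (k : ℤ) ^ (s + 1) := by
      obtain ⟨c, hc⟩ := refl_pow p k s hs
      refine ⟨(k + s * p) * c - s ^ 2 * k ^ (s - 1), ?_⟩
      have : (k : ℤ) ^ s = k * k ^ (s - 1) := by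
        rw [← pow_succ', Nat.sub_add_cancel h0]
      rw [pow_succ]
      rw [this] at hc ⊢
      linear_combination (k + s * p : ℤ) * hc
    have i2 := PDvd.invPow (k := p - k) hp (by omega) (by omega) s
    rw [Nat.cast_sub hk.2.le] at i2
    have := PDvd.mul0 hp (PDvd.mul0 hp (PDvd.mul0 hp (PDvd.ofInt hp hd)
      (PDvd.ofInt0 hp ((-1) ^ k)))
      (PDvd.invPow hp hk.1 hk.2 (s + 1))) i2
    convert this using 1
    push_cast
    field_simp
    ring
  have a2 := PDvd.mul hp (PDvd.ofInt (l := 1) hp (z := s * p) (by simp)) h2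
  have a3 := PDvd.mul0 hp (PDvd.sub hp a1 a2)
    (PDvd.invNat (k := 2) hp (by omega) (by omega))
  convert a3 using 1
  have e1 : (2 : ℚ) ^ ((1 : ℤ) - ((s + 1 : ℕ) : ℤ)) = 2 ^ (-(s : ℤ)) := by
    congr 1; push_cast; ring
  rw [e1]
  push_cast
  have : (s : ℚ) + 1 ≠ 0 := by positivity
  field_simp
  ring

theorem choose_pred_prime {p : ℕ} (hp : p.Prime) (j : ℕ) (hj : j < p) :
    (p : ℤ) ∣ (-1) ^ j - ((p - 1).choose j : ℤ) := by
  induction j with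
  | zero => simp
  | succ j ih =>
    have h1 := ih (by omega)
    have h2 : (p : ℤ) ∣ (p.choose (j + 1) : ℤ) := by
      exact_mod_cast hp.dvd_choose_self (by omega) hj
    have h3 : (p.choose (j + 1) : ℤ) = (p - 1).choose j + (p - 1).choose (j + 1) := by
      have := Nat.choose_succ_succ (p - 1) j
      rw [Nat.succ_eq_add_one, Nat.sub_add_cancel hp.one_le] at this
      exact_mod_cast this
    obtain ⟨a, ha⟩ := h1
    obtain ⟨b, hb⟩ := h2
    refine ⟨-a - b, ?_⟩
    rw [pow_succ]
    linear_combination -ha - hb + h3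

theorem part_one (p : ℕ) (hp : p.Prime) :
    PDvd p 1 ((∑ k ∈ Finset.Ico 1 p, (-1 : ℚ) ^ k / (k : ℚ)) -
        (-2 * (((2 : ℚ) ^ (p - 1) - 1) / (p : ℚ)))) := by
  have hpq : (p : ℚ) ≠ 0 := by exact_mod_cast hp.ne_zero
  have e : (-2 * (((2 : ℚ) ^ (p - 1) - 1) / (p : ℚ))) =
      ∑ k ∈ Finset.Ico 1 p, -(((p - 1).choose (k - 1) : ℚ) / k) := by
    have h1 : (2 : ℚ) ^ p = 1 + ∑ k ∈ Finset.Ico 1 p, (p.choose k : ℚ) + 1 := by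
      have := Nat.sum_range_choose p
      rw [Finset.sum_range_succ, Finset.range_eq_Ico,
        Finset.sum_eq_sum_Ico_succ_bot hp.pos] at this
      have h := congrArg (Nat.cast : ℕ → ℚ) this
      push_cast at h
      rw [← h]; simp
    have h2 : ∑ k ∈ Finset.Ico 1 p, -(((p - 1).choose (k - 1) : ℚ) / k) =
        -(∑ k ∈ Finset.Ico 1 p, (p.choose k : ℚ)) / p := by
      rw [← Finset.sum_neg_distrib, Finset.sum_div]
      refine Finset.sum_congr rfl fun k hk => ?_
      have hk := Finset.mem_Ico.mp hk
      have hk0 : (k : ℚ) ≠ 0 := by norm_cast; omega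
      have := Nat.add_one_mul_choose_eq (p - 1) (k - 1)
      rw [Nat.sub_add_cancel hp.one_le, Nat.sub_add_cancel hk.1] at this
      have h := congrArg (Nat.cast : ℕ → ℚ) this
      push_cast at h
      field_simp
      linear_combination -h
    have h3 : (2 : ℚ) ^ p = 2 ^ (p - 1) * 2 := by
      rw [← pow_succ, Nat.sub_add_cancel hp.one_le]
    rw [h2]
    field_simp
    linear_combination h3 - h1
  rw [e, ← Finset.sum_sub_distrib]
  apply PDvd.sum hp
  intro k hk
  have hk := Finset.mem_Ico.mp hk
  have := PDvd.neg (PDvd.mul0 hp (PDvd.ofInt (l := 1) hp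
    (by simpa using choose_pred_prime hp (k - 1) (by omega))) (PDvd.invNat hp hk.1 hk.2))
  convert this using 1
  obtain ⟨j, rfl⟩ : ∃ j, k = j + 1 := ⟨k - 1, by omega⟩
  push_cast
  rw [pow_succ]
  ring

/-- Theorem `thm:FESdepth1`.
Congruences for the depth-one alternating sums `Σ_{k=1}^{p-1} (-1)^k/k^s`:
(i) for `s = 1`, `≡ -2(2^{p-1}-1)/p (mod p)`;
(ii) for odd `s > 2`, `≡ -2(1-2^{1-s}) B_{p-s}/s (mod p)`;
(iii) for even `s > 0`, `≡ s(1-2^{-s}) p B_{p-s-1}/(s+1) (mod p²)`. -/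
theorem alternating_depth_one :
    (∃ N, ∀ p ≥ N, Nat.Prime p →
      RatModEq p 1 (∑ k ∈ Finset.Icc 1 (p - 1), (-1 : ℚ) ^ k / (k : ℚ))
        (-2 * (((2 : ℚ) ^ (p - 1) - 1) / (p : ℚ)))) ∧
    (∀ s : ℕ, Odd s → 2 < s → ∃ N, ∀ p ≥ N, Nat.Prime p →
      RatModEq p 1 (∑ k ∈ Finset.Icc 1 (p - 1), (-1 : ℚ) ^ k / (k : ℚ) ^ s)
        (-2 * (1 - (2 : ℚ) ^ ((1 : ℤ) - (s : ℤ))) * (bernoulli (p - s) / (s : ℚ)))) ∧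
    (∀ s : ℕ, Even s → 0 < s → ∃ N, ∀ p ≥ N, Nat.Prime p →
      RatModEq p 2 (∑ k ∈ Finset.Icc 1 (p - 1), (-1 : ℚ) ^ k / (k : ℚ) ^ s)
        ((s : ℚ) * (1 - (2 : ℚ) ^ (-(s : ℤ))) * (p : ℚ) *
          (bernoulli (p - s - 1) / ((s : ℚ) + 1)))) := by
  have hI : ∀ p : ℕ, p.Prime → Finset.Icc 1 (p - 1) = Finset.Ico 1 p := by
    intro p hp
    have := hp.pos
    ext k
    simp only [Finset.mem_Icc, Finset.mem_Ico]
    omega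
  refine ⟨⟨0, fun p _ hp => ?_⟩, fun s hs h2 => ⟨s + 3, fun p hps hp => ?_⟩,
    fun s hs h0 => ⟨s + 4, fun p hps hp => ?_⟩⟩
  · rw [hI p hp]
    exact (part_one p hp).toRatModEq hp
  · rw [hI p hp]
    exact (part_two s p hs h2 hps hp).toRatModEq hp
  · rw [hI p hp]
    exact (part_three s p hs h0 hps hp).toRatModEq hp
end

section
/- Let s and t be positive integers. Then for all sufficiently large primes p: H_{p−1}(s,t) ≡ H^⋆_{p−1}(s,t) ≡ (−1)^s · C(s+t, s) · B_{p−s−t}/(s+t) (mod p), where C(s+t,s) is the binomial coefficient. -/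
open scoped BigOperators

/-- `x` is a `p`-integral rational with reduction `a` modulo `p`. -/
def Red (p : ℕ) (x : ℚ) (a : ZMod p) : Prop :=
  ∃ n d : ℤ, (d : ZMod p) ≠ 0 ∧ x * d = n ∧ a * d = n

section
variable {p : ℕ} [hp : Fact p.Prime]

theorem Red.dne {d : ℤ} (h : (d : ZMod p) ≠ 0) : (d : ℚ) ≠ 0 := by
  intro h0
  apply h
  have : d = 0 := by exact_mod_cast h0
  simp [this]

theorem Red.add {x y : ℚ} {a b : ZMod p} (h : Red p x a) (h' : Red p y b) :
    Red p (x + y) (a + b) := by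
  obtain ⟨n, d, h1, h2, h3⟩ := h
  obtain ⟨n', d', h1', h2', h3'⟩ := h'
  refine ⟨n * d' + n' * d, d * d', ?_, ?_, ?_⟩
  · push_cast; exact mul_ne_zero h1 h1'
  · push_cast; rw [← h2, ← h2']; ring
  · push_cast; rw [← h3, ← h3']; ring

theorem Red.mul {x y : ℚ} {a b : ZMod p} (h : Red p x a) (h' : Red p y b) :
    Red p (x * y) (a * b) := by
  obtain ⟨n, d, h1, h2, h3⟩ := h
  obtain ⟨n', d', h1', h2', h3'⟩ := h'
  refine ⟨n * n', d * d', ?_, ?_, ?_⟩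
  · push_cast; exact mul_ne_zero h1 h1'
  · push_cast; rw [← h2, ← h2']; ring
  · push_cast; rw [← h3, ← h3']; ring

theorem Red.int (n : ℤ) : Red p n n := ⟨n, 1, by simp, by simp, by simp⟩

theorem Red.nat (n : ℕ) : Red p n n := by simpa using Red.int (p := p) (n : ℤ)

theorem Red.neg {x : ℚ} {a : ZMod p} (h : Red p x a) : Red p (-x) (-a) := by
  simpa using (Red.int (p := p) (-1)).mul h

theorem Red.sub {x y : ℚ} {a b : ZMod p} (h : Red p x a) (h' : Red p y b) :
    Red p (x - y) (a - b) := by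
  simpa [sub_eq_add_neg] using h.add h'.neg

theorem Red.pow {x : ℚ} {a : ZMod p} (h : Red p x a) (k : ℕ) : Red p (x ^ k) (a ^ k) := by
  induction k with
  | zero => simpa using Red.nat (p := p) 1
  | succ k ih => rw [pow_succ, pow_succ]; exact ih.mul h

theorem Red.inv {x : ℚ} {a : ZMod p} (h : Red p x a) (ha : a ≠ 0) : Red p x⁻¹ a⁻¹ := by
  obtain ⟨n, d, h1, h2, h3⟩ := h
  have hn : (n : ZMod p) ≠ 0 := by rw [← h3]; exact mul_ne_zero ha h1
  have hx : x ≠ 0 := by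
    rintro rfl
    apply Red.dne hn
    rw [← h2]; simp
  refine ⟨d, n, hn, ?_, ?_⟩
  · rw [← h2]; field_simp
  · rw [← h3]; field_simp

theorem Red.div {x y : ℚ} {a b : ZMod p} (h : Red p x a) (h' : Red p y b) (hb : b ≠ 0) :
    Red p (x / y) (a / b) := by
  rw [div_eq_mul_inv, div_eq_mul_inv]; exact h.mul (h'.inv hb)

theorem Red.sum {ι : Type*} (S : Finset ι) (f : ι → ℚ) (g : ι → ZMod p)
    (h : ∀ i ∈ S, Red p (f i) (g i)) : Red p (∑ i ∈ S, f i) (∑ i ∈ S, g i) := by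
  classical
  induction S using Finset.induction_on with
  | empty => simpa using Red.nat (p := p) 0
  | insert i S hi ih =>
    rw [Finset.sum_insert hi, Finset.sum_insert hi]
    exact (h i (by simp)).add (ih fun j hj => h j (by simp [hj]))

theorem Red.unique {x : ℚ} {a b : ZMod p} (h : Red p x a) (h' : Red p x b) : a = b := by
  obtain ⟨n, d, h1, h2, h3⟩ := h.sub h'
  have hn : n = 0 := by
    have : (n : ℚ) = 0 := by rw [← h2]; simp
    exact_mod_cast this
  subst hn
  simp only [Int.cast_zero, mul_eq_zero, h1, or_false] at h3
  exact sub_eq_zero.mp h3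

theorem Red.modEq {x y : ℚ} {a : ZMod p} (h : Red p x a) (h' : Red p y a) :
    RatModEq p 1 x y := by
  by_cases hxy : x = y
  · exact Or.inl hxy
  right
  obtain ⟨n, d, h1, h2, h3⟩ := h.sub h'
  have hd : (d : ℚ) ≠ 0 := Red.dne h1
  have hn : (n : ℚ) ≠ 0 := by
    rw [← h2]; exact mul_ne_zero (sub_ne_zero.mpr hxy) hd
  have hx : x - y = n / d := by rw [eq_div_iff hd, h2]
  have hn0 : (n : ZMod p) = 0 := by rw [← h3]; simp
  rw [ZMod.intCast_zmod_eq_zero_iff_dvd] at hn0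
  have hdd : ¬ (p : ℤ) ∣ d := by
    rwa [← ZMod.intCast_zmod_eq_zero_iff_dvd]
  rw [hx, padicValRat.div hn hd, padicValRat.of_int, padicValRat.of_int,
    padicValInt.eq_zero_of_not_dvd hdd]
  have hnz : n ≠ 0 := by exact_mod_cast hn
  have := (padicValInt_dvd_iff (p := p) 1 n).mp (by simpa using hn0)
  have h4 : 1 ≤ padicValInt p n := by tauto
  push_cast
  simp only [sub_zero]
  exact_mod_cast h4

theorem nat_ne {k : ℕ} (h0 : 0 < k) (h : k < p) : (k : ZMod p) ≠ 0 := by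
  rw [Ne, ZMod.natCast_eq_zero_iff]
  exact Nat.not_dvd_of_pos_of_lt h0 h

theorem red_bernoulli' (n : ℕ) (hn : n + 1 < p) : ∃ b, Red p (bernoulli' n) b := by
  induction n using Nat.strong_induction_on with
  | _ n ih =>
    have : ∀ k, ∃ b, k ∈ Finset.range n →
        Red p ((n.choose k : ℚ) / (n - k + 1) * bernoulli' k) b := by
      intro k
      by_cases hk : k < n
      · obtain ⟨b, hb⟩ := ih k hk (by omega)
        refine ⟨((n.choose k : ℕ) : ZMod p) / ((n - k + 1 : ℕ) : ZMod p) * b, fun _ => ?_⟩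
        have := ((Red.nat (p := p) (n.choose k)).div (Red.nat (p := p) (n - k + 1))
          (nat_ne (by omega) (by omega))).mul hb
        convert this using 3
        push_cast [hk.le]; ring
      · exact ⟨0, fun h => absurd (Finset.mem_range.mp h) hk⟩
    choose g hg using this
    rw [bernoulli'_def]
    refine ⟨_, Red.sub (by simpa using Red.nat (p := p) 1) (Red.sum _ _ g hg)⟩

theorem red_bernoulli (n : ℕ) (hn : n + 1 < p) : ∃ b, Red p (bernoulli n) b := by
  obtain ⟨b, hb⟩ := red_bernoulli' n hn
  refine ⟨(-1) ^ n * b, ?_⟩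
  have := ((Red.int (p := p) (-1)).pow n).mul hb
  simpa [bernoulli] using this

theorem sum_pow_Icc (e : ℕ) :
    ∑ k ∈ Finset.Icc 1 (p - 1), (k : ZMod p) ^ e = if p - 1 ∣ e then -1 else 0 := by
  have := FiniteField.sum_pow_units (ZMod p) e
  rw [ZMod.card] at this
  rw [← this]
  symm
  refine Finset.sum_bij (fun u _ => (u : ZMod p).val) ?_ ?_ ?_ ?_
  · intro u _
    have h1 := ZMod.val_lt (u : ZMod p)
    have h2 : (u : ZMod p).val ≠ 0 := by
      rw [Ne, ZMod.val_eq_zero]; exact u.ne_zero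
    rw [Finset.mem_Icc]; omega
  · intro u _ v _ h
    exact Units.ext (ZMod.val_injective p h)
  · intro k hk
    rw [Finset.mem_Icc] at hk
    have hpp := hp.out.two_le
    refine ⟨Units.mk0 (k : ZMod p) (nat_ne (by omega) (by omega)), Finset.mem_univ _, ?_⟩
    simp only [Units.val_mk0]
    exact ZMod.val_cast_of_lt (by omega)
  · intro u _
    simp

theorem inv_pow_eq {k e : ℕ} (h0 : 0 < k) (h : k < p) (he : e ≤ p - 1) :
    1 / (k : ZMod p) ^ e = (k : ZMod p) ^ (p - 1 - e) := by
  have hk := nat_ne h0 h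
  rw [div_eq_iff (pow_ne_zero _ hk), ← pow_add, Nat.sub_add_cancel he,
    ZMod.pow_card_sub_one_eq_one hk]

theorem choose_red (s t : ℕ) (h : s + t < p) :
    (((p - t).choose s : ℕ) : ZMod p) * (s + t) = (-1) ^ s * ((s + t).choose s : ℕ) * t := by
  induction s with
  | zero => simp
  | succ s ih =>
    have ih := ih (by omega)
    have hs : ((s + 1 : ℕ) : ZMod p) ≠ 0 := nat_ne (by omega) (by omega)
    apply mul_right_cancel₀ hs
    have e1 : (((p - t).choose (s + 1) : ℕ) : ZMod p) * ((s + 1 : ℕ) : ZMod p)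
        = ((p - t).choose s : ℕ) * (-(s + t)) := by
      rw [← Nat.cast_mul, Nat.choose_succ_right_eq, Nat.cast_mul]
      congr 1
      rw [Nat.sub_sub, Nat.cast_sub (by omega)]
      push_cast; simp; ring
    have e2 : (((s + 1 + t).choose (s + 1) : ℕ) : ZMod p) * ((s + 1 : ℕ) : ZMod p)
        = (s + t + 1) * ((s + t).choose s : ℕ) := by
      rw [show s + 1 + t = s + t + 1 by ring, ← Nat.cast_mul, ← Nat.add_one_mul_choose_eq]
      push_cast; ring
    push_cast at *
    linear_combination (s + 1 + t : ZMod p) * e1 - (s+1+t : ZMod p) * ih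
      - (-1) ^ (s + 1) * (t : ZMod p) * e2

theorem main_sum (s t : ℕ) (hs : 0 < s) (ht : 0 < t) (h : s + t + 1 < p)
    (b : ZMod p) (hb : Red p (bernoulli (p - s - t)) b) :
    ∑ k ∈ Finset.Icc 1 (p - 1), 1 / (k : ZMod p) ^ s *
      ∑ j ∈ Finset.Icc 1 (k - 1), 1 / (j : ZMod p) ^ t
      = (-1) ^ s * ((s + t).choose s : ℕ) * (b / ((s + t : ℕ) : ZMod p)) := by
  have hB : ∀ i, ∃ c, i ∈ Finset.range (p - 1 - t + 1) → Red p (bernoulli i) c := by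
    intro i
    by_cases hi : i + 1 < p
    · obtain ⟨c, hc⟩ := red_bernoulli i hi
      exact ⟨c, fun _ => hc⟩
    · exact ⟨0, fun h => by rw [Finset.mem_range] at h; omega⟩
  choose c hc using hB
  have hcb : c (p - s - t) = b := (hc _ (by rw [Finset.mem_range]; omega)).unique hb
  have hm : ((p - 1 - t + 1 : ℕ) : ZMod p) ≠ 0 := nat_ne (by omega) (by omega)
  have inner : ∀ k ∈ Finset.Icc 1 (p - 1), ∑ j ∈ Finset.Icc 1 (k - 1), 1 / (j : ZMod p) ^ t =
      ∑ i ∈ Finset.range (p - 1 - t + 1), c i * ((p - 1 - t + 1).choose i : ℕ) *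
        (k : ZMod p) ^ (p - 1 - t + 1 - i) / ((p - 1 - t + 1 : ℕ) : ZMod p) := by
    intro k hk
    rw [Finset.mem_Icc] at hk
    have e1 : ∑ j ∈ Finset.Icc 1 (k - 1), 1 / (j : ZMod p) ^ t =
        ∑ j ∈ Finset.range k, (j : ZMod p) ^ (p - 1 - t) := by
      have : Finset.range k = insert 0 (Finset.Icc 1 (k - 1)) := by
        ext x; simp; omega
      rw [this, Finset.sum_insert (by simp)]
      rw [Nat.cast_zero, zero_pow (by omega), zero_add]
      refine Finset.sum_congr rfl fun j hj => ?_
      rw [Finset.mem_Icc] at hj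
      exact inv_pow_eq (by omega) (by omega) (by omega)
    rw [e1]
    have h1 : Red p (∑ j ∈ Finset.range k, (j : ℚ) ^ (p - 1 - t))
        (∑ j ∈ Finset.range k, (j : ZMod p) ^ (p - 1 - t)) :=
      Red.sum _ _ _ fun j _ => (Red.nat j).pow _
    rw [sum_range_pow] at h1
    refine h1.unique (Red.sum _ _ _ fun i hi => ?_)
    have := (((hc i hi).mul (Red.nat ((p - 1 - t + 1).choose i))).mul ((Red.nat k).pow (p - 1 - t + 1 - i))).div
      (Red.nat (p - 1 - t + 1)) hm
    simpa using this
  have step : ∑ k ∈ Finset.Icc 1 (p - 1), 1 / (k : ZMod p) ^ s *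
      ∑ j ∈ Finset.Icc 1 (k - 1), 1 / (j : ZMod p) ^ t =
      ∑ i ∈ Finset.range (p - 1 - t + 1), c i * ((p - 1 - t + 1).choose i : ℕ) /
        ((p - 1 - t + 1 : ℕ) : ZMod p) *
        ∑ k ∈ Finset.Icc 1 (p - 1), (k : ZMod p) ^ (p - 1 - s + (p - 1 - t + 1 - i)) := by
    simp only [Finset.mul_sum]
    rw [Finset.sum_comm]
    refine Finset.sum_congr rfl fun k hk => ?_
    rw [← Finset.mul_sum, inner k hk, Finset.mul_sum]
    rw [Finset.mem_Icc] at hk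
    rw [inv_pow_eq (by omega) (by omega) (by omega)]
    refine Finset.sum_congr rfl fun i _ => ?_
    rw [pow_add]; ring
  rw [step, Finset.sum_eq_single (p - s - t)]
  · rw [sum_pow_Icc, if_pos (by
      rw [show p - 1 - s + (p - 1 - t + 1 - (p - s - t)) = p - 1 by omega]), hcb]
    have e : p - 1 - t + 1 = p - t := by omega
    have hcs : (p - t).choose (p - s - t) = (p - t).choose s := by
      rw [← Nat.choose_symm (show s ≤ p - t by omega)]
      congr 1; omega
    have hpt : ((p - t : ℕ) : ZMod p) = -t := by
      rw [Nat.cast_sub (by omega)]; simp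
    have ht0 : (t : ZMod p) ≠ 0 := nat_ne ht (by omega)
    have hst0 : ((s + t : ℕ) : ZMod p) ≠ 0 := nat_ne (by omega) (by omega)
    have key := choose_red (p := p) s t (by omega)
    rw [e, hcs, hpt]
    push_cast at hst0 ⊢
    field_simp
    linear_combination b * key
  · intro i hi hne
    rw [Finset.mem_range] at hi
    rw [sum_pow_Icc, if_neg, mul_zero]
    rintro ⟨q, hq⟩
    have hq0 : q ≠ 0 := by rintro rfl; omega
    have hq1 : q ≠ 1 := by rintro rfl; omega
    have : (p - 1) * 2 ≤ (p - 1) * q := Nat.mul_le_mul_left _ (by omega)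
    omega
  · intro hn
    exact absurd (Finset.mem_range.mpr (by omega)) hn

end

/-- Theorem `thm:FMZVdepth2superbity1`, first part.
For positive integers `s, t` and all sufficiently large primes `p`:
`H_{p-1}(s,t) ≡ H⋆_{p-1}(s,t) ≡ (-1)^s C(s+t,s) B_{p-s-t}/(s+t) (mod p)`. -/
theorem depth_two_fmzv (s t : ℕ) (hs : 0 < s) (ht : 0 < t) :
    ∃ N, ∀ p ≥ N, Nat.Prime p →
      RatModEq p 1 (AMHS (p - 1) [(s, (1 : ℚ)), (t, (1 : ℚ))])
        ((-1 : ℚ) ^ s * ((s + t).choose s : ℚ) * (bernoulli (p - s - t) / ((s + t : ℕ) : ℚ))) ∧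
      RatModEq p 1 (AMHSstar (p - 1) [(s, (1 : ℚ)), (t, (1 : ℚ))])
        ((-1 : ℚ) ^ s * ((s + t).choose s : ℚ) * (bernoulli (p - s - t) / ((s + t : ℕ) : ℚ))) := by
  refine ⟨s + t + 2, fun p hpN hp => ?_⟩
  have : Fact p.Prime := ⟨hp⟩
  obtain ⟨b, hb⟩ := red_bernoulli (p := p) (p - s - t) (by omega)
  have hmain := main_sum s t hs ht (by omega) b hb
  have hR : Red p ((-1 : ℚ) ^ s * ((s + t).choose s : ℚ) *
      (bernoulli (p - s - t) / ((s + t : ℕ) : ℚ)))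
      ((-1) ^ s * ((s + t).choose s : ℕ) * (b / ((s + t : ℕ) : ZMod p))) := by
    have h1 : Red p (-1) (-1) := by simpa using Red.int (p := p) (-1)
    exact ((h1.pow s).mul (Red.nat _)).mul (hb.div (Red.nat _) (nat_ne (by omega) (by omega)))
  have hterm : ∀ k e : ℕ, 0 < k → k < p → Red p (1 / (k : ℚ) ^ e) (1 / (k : ZMod p) ^ e) := by
    intro k e h0 hk
    have h1 : Red p 1 1 := by simpa using Red.nat (p := p) 1
    exact h1.div ((Red.nat k).pow e) (pow_ne_zero _ (nat_ne h0 hk))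
  have hA : Red p (AMHS (p - 1) [(s, (1 : ℚ)), (t, (1 : ℚ))])
      (∑ k ∈ Finset.Icc 1 (p - 1), 1 / (k : ZMod p) ^ s *
        ∑ j ∈ Finset.Icc 1 (k - 1), 1 / (j : ZMod p) ^ t) := by
    simp only [AMHS, one_pow, mul_one]
    refine Red.sum _ _ _ fun k hk => ?_
    rw [Finset.mem_Icc] at hk
    refine (hterm k s (by omega) (by omega)).mul (Red.sum _ _ _ fun j hj => ?_)
    rw [Finset.mem_Icc] at hj
    exact hterm j t (by omega) (by omega)
  have hS : AMHSstar (p - 1) [(s, (1 : ℚ)), (t, (1 : ℚ))] =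
      AMHS (p - 1) [(s, (1 : ℚ)), (t, (1 : ℚ))] +
        ∑ k ∈ Finset.Icc 1 (p - 1), 1 / (k : ℚ) ^ (s + t) := by
    simp only [AMHS, AMHSstar, one_pow, mul_one]
    rw [← Finset.sum_add_distrib]
    refine Finset.sum_congr rfl fun k hk => ?_
    rw [Finset.mem_Icc] at hk
    obtain ⟨m, rfl⟩ : ∃ m, k = m + 1 := ⟨k - 1, by omega⟩
    rw [Finset.sum_Icc_succ_top (by omega), Nat.add_sub_cancel, mul_add, pow_add]
    congr 1
    rw [div_mul_div_comm, one_mul]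
  have hZ : Red p (∑ k ∈ Finset.Icc 1 (p - 1), 1 / (k : ℚ) ^ (s + t)) 0 := by
    have e : ∑ k ∈ Finset.Icc 1 (p - 1), 1 / (k : ZMod p) ^ (s + t) = 0 := by
      have e' : ∀ k ∈ Finset.Icc 1 (p - 1), 1 / (k : ZMod p) ^ (s + t) =
          (k : ZMod p) ^ (p - 1 - (s + t)) := by
        intro k hk
        rw [Finset.mem_Icc] at hk
        exact inv_pow_eq (by omega) (by omega) (by omega)
      rw [Finset.sum_congr rfl e', sum_pow_Icc, if_neg]
      intro hd
      have := Nat.le_of_dvd (by omega) hd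
      omega
    rw [← e]
    refine Red.sum _ _ _ fun k hk => ?_
    rw [Finset.mem_Icc] at hk
    exact hterm k _ (by omega) (by omega)
  rw [hmain] at hA
  refine ⟨hA.modEq hR, ?_⟩
  have hAS := hA.add hZ
  rw [add_zero, ← hS] at hAS
  exact hAS.modEq hR
end
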